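/- The congruence two subgroup Γ⁵₂ is generated by the following 16 matrices, each of which is an involution lying in Γ⁵₂: (i) for each i = 1,…,5, the diagonal matrix Dᵢ equal to the identity except that its (i,i) entry is −1; (ii) for each pair i < j in {1,…,5}, the matrix R_{ij} equal to the identity except for the entries (i,i) = −1, (i,j) = −2, (i,6) = 2, (j,i) = −2, (j,j) = −1, (j,6) = 2, (6,i) = −2, (6,j) = −2, (6,6) = 3; (iii) the matrix F with F(i,i) = −1 and F(i,j) = −2 for distinct i, j ∈ {1,…,5}, F(i,6) = 4 and F(6,i) = −4 for i ∈ {1,…,5}, and F(6,6) = 9. (These are the reflections of H⁵ in the 16 sides of the right-angled polytope P⁵.) -/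

import Mathlib

open Matrix

/-- The matrix `J = diag(1,1,1,1,1,-1)` of the Lorentzian quadratic form. -/
def lorJ : Matrix (Fin 6) (Fin 6) ℤ := Matrix.diagonal ![1, 1, 1, 1, 1, -1]

/-- A 6×6 matrix is Lorentzian if `Aᵀ J A = J`. -/
def IsLorentzian (A : Matrix (Fin 6) (Fin 6) ℤ) : Prop := Aᵀ * lorJ * A = lorJ

/-- A Lorentzian matrix is positive if its (6,6) entry is positive. -/
def IsPosLorentzian (A : Matrix (Fin 6) (Fin 6) ℤ) : Prop := IsLorentzian A ∧ 0 < A 5 5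

/-- A matrix is congruent to the identity matrix modulo two. -/
def CongrIdModTwo (A : Matrix (Fin 6) (Fin 6) ℤ) : Prop :=
  ∀ i j, (2 : ℤ) ∣ (A i j - (1 : Matrix (Fin 6) (Fin 6) ℤ) i j)

/-- For `i ∈ {1,…,5}`, the diagonal matrix equal to the identity except that its
(i,i) entry is −1. -/
def Dmat (i : Fin 5) : Matrix (Fin 6) (Fin 6) ℤ :=
  Matrix.diagonal (fun j => if j = i.castSucc then -1 else 1)

/-- For `i < j` in `{1,…,5}`, the matrix equal to the identity except for the entries
(i,i) = −1, (i,j) = −2, (i,6) = 2, (j,i) = −2, (j,j) = −1, (j,6) = 2,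
(6,i) = −2, (6,j) = −2, (6,6) = 3. -/
def Rmat (i j : Fin 5) : Matrix (Fin 6) (Fin 6) ℤ :=
  Matrix.of fun a b =>
    if a = i.castSucc ∧ b = i.castSucc then -1
    else if a = i.castSucc ∧ b = j.castSucc then -2
    else if a = i.castSucc ∧ b = 5 then 2
    else if a = j.castSucc ∧ b = i.castSucc then -2
    else if a = j.castSucc ∧ b = j.castSucc then -1
    else if a = j.castSucc ∧ b = 5 then 2
    else if a = 5 ∧ b = i.castSucc then -2
    else if a = 5 ∧ b = j.castSucc then -2
    else if a = 5 ∧ b = 5 then 3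
    else if a = b then 1
    else 0

/-- The matrix `F` with `F(i,i) = −1` and `F(i,j) = −2` for distinct `i, j ∈ {1,…,5}`,
`F(i,6) = 4` and `F(6,i) = −4` for `i ∈ {1,…,5}`, and `F(6,6) = 9`. -/
def Fmat : Matrix (Fin 6) (Fin 6) ℤ :=
  Matrix.of fun a b =>
    if a = 5 ∧ b = 5 then 9
    else if a = 5 then -4
    else if b = 5 then 4
    else if a = b then -1
    else -2

/-- A point of the polytope `P⁵` with even spatial coordinates and odd time coordinate on the
hyperboloid has time coordinate at most one. -/
lemma time_le_one_of_mem_polytope {x : Fin 5 → ℤ} {t : ℤ} (hx : ∀ i, 0 ≤ x i)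
    (hx_even : ∀ i, 2 ∣ x i) (ht : 0 < t) (ht_odd : 2 ∣ t - 1)
    (hnorm : ∑ i, x i ^ 2 = t ^ 2 - 1) (hpair : ∀ i j, i ≠ j → x i + x j ≤ t)
    (hsum : ∑ i, x i ≤ 2 * t) : t ≤ 1 := by
  by_contra! hlt
  obtain ⟨i, hmax⟩ := Finite.exists_max x
  have hsplit := Finset.add_sum_erase Finset.univ x (Finset.mem_univ i)
  have hsplit_sq := Finset.add_sum_erase Finset.univ (fun j => x j ^ 2) (Finset.mem_univ i)
  have hi := hx i
  have hi_lt : x i < t := by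
    have := Finset.sum_nonneg fun j (_ : j ∈ Finset.univ.erase i) => sq_nonneg (x j)
    nlinarith
  have hbound : ∀ b, (∀ j, j ≠ i → x j ≤ b) →
      ∑ j ∈ Finset.univ.erase i, x j ^ 2 ≤ b * ∑ j ∈ Finset.univ.erase i, x j := by
    intro b hb
    rw [Finset.mul_sum]
    refine Finset.sum_le_sum fun j hj => ?_
    nlinarith [hx j, hb j (Finset.ne_of_mem_erase hj)]
  rcases le_total (2 * x i) (t - 1) with h | h
  · have := hbound (x i) fun j _ => hmax j
    have : t ^ 2 - 1 ≤ x i * ∑ j, x j := by rw [← hnorm, ← hsplit, ← hsplit_sq]; nlinarith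
    nlinarith
  · have hb := hbound (t - 1 - x i) fun j hj => by
      have := hpair j i hj
      have := hx_even i
      have := hx_even j
      omega
    have hrest : ∑ j ∈ Finset.univ.erase i, x j ≤ 2 * t - x i := by linarith
    have : (t - 1 - x i) * ∑ j ∈ Finset.univ.erase i, x j ≤ (t - 1 - x i) * (2 * t - x i) :=
      mul_le_mul_of_nonneg_left hrest (by linarith)
    nlinarith [mul_nonneg (sub_nonneg.2 h) (show 0 ≤ t - 1 - x i by linarith)]

/-- The Lorentzian product of two columns of a Lorentzian matrix. -/
lemma IsLorentzian.sum_col_mul_col {A : Matrix (Fin 6) (Fin 6) ℤ} (hA : IsLorentzian A)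
    (a b : Fin 6) :
    ∑ i : Fin 5, A i.castSucc a * A i.castSucc b - A 5 a * A 5 b = lorJ a b := by
  rw [← congrFun₂ hA a b]
  simp [lorJ, Matrix.mul_apply, Fin.sum_univ_succ]
  ring

/-- Invertible diagonal matrices. -/
def diagonalGL : (Fin 6 → ℤˣ) →* GL (Fin 6) ℤ :=
  (Units.map (Matrix.diagonalRingHom (Fin 6) ℤ).toMonoidHom).comp
    (MulEquiv.piUnits (M := fun _ : Fin 6 => ℤ)).symm.toMonoidHom

lemma coe_diagonalGL (f : Fin 6 → ℤˣ) :
    (diagonalGL f : Matrix (Fin 6) (Fin 6) ℤ) = Matrix.diagonal fun i => (f i : ℤ) := rfl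

lemma coe_diagonalGL_mul_apply (f : Fin 6 → ℤˣ) (A : GL (Fin 6) ℤ) (i j : Fin 6) :
    ((diagonalGL f * A : GL (Fin 6) ℤ) : Matrix (Fin 6) (Fin 6) ℤ) i j = f i * A.1 i j := by
  simp [coe_diagonalGL]

lemma diagonalGL_mem {H : Subgroup (GL (Fin 6) ℤ)}
    (hH : ∀ g : GL (Fin 6) ℤ, (∃ i, (g : Matrix (Fin 6) (Fin 6) ℤ) = Dmat i) → g ∈ H)
    {f : Fin 6 → ℤˣ} (hf : f 5 = 1) : diagonalGL f ∈ H := by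
  rw [← Subgroup.mem_comap, ← Finset.univ_prod_mulSingle f]
  refine Subgroup.prod_mem _ fun i _ => ?_
  rcases Int.units_eq_one_or (f i) with h | h
  · simp [h, one_mem]
  · induction i using Fin.lastCases with
    | last => exact absurd (hf.symm.trans h) (by decide)
    | cast i =>
      refine hH _ ⟨i, ?_⟩
      rw [coe_diagonalGL, Dmat, h]
      congr 1
      ext j
      by_cases hj : j = i.castSucc
      · subst hj; simp
      · simp [hj]

lemma Dmat_mul_self (i : Fin 5) : Dmat i * Dmat i = 1 := by decide +kernel +revert

lemma Dmat_ne_one (i : Fin 5) : Dmat i ≠ 1 := by decide +kernel +revert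

lemma Rmat_mul_self {i j : Fin 5} (hij : i < j) : Rmat i j * Rmat i j = 1 := by
  decide +kernel +revert

lemma Rmat_ne_one (i j : Fin 5) : Rmat i j ≠ 1 := by decide +kernel +revert

lemma Fmat_mul_self : Fmat * Fmat = 1 := by decide +kernel

lemma Fmat_ne_one : Fmat ≠ 1 := by decide +kernel

lemma Dmat_isPosLorentzian (i : Fin 5) : IsPosLorentzian (Dmat i) := by
  unfold IsPosLorentzian IsLorentzian; decide +kernel +revert

lemma Rmat_isPosLorentzian {i j : Fin 5} (hij : i < j) : IsPosLorentzian (Rmat i j) := by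
  unfold IsPosLorentzian IsLorentzian; decide +kernel +revert

lemma Fmat_isPosLorentzian : IsPosLorentzian Fmat := by
  unfold IsPosLorentzian IsLorentzian; decide +kernel

lemma Dmat_congrIdModTwo (i : Fin 5) : CongrIdModTwo (Dmat i) := by
  unfold CongrIdModTwo; decide +kernel +revert

lemma Rmat_congrIdModTwo {i j : Fin 5} (hij : i < j) : CongrIdModTwo (Rmat i j) := by
  unfold CongrIdModTwo; decide +kernel +revert

lemma Fmat_congrIdModTwo : CongrIdModTwo Fmat := by
  unfold CongrIdModTwo; decide +kernel

lemma Rmat_mul_apply_last {i j : Fin 5} (hij : i < j) (A : Matrix (Fin 6) (Fin 6) ℤ) :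
    (Rmat i j * A) 5 5 = 3 * A 5 5 - 2 * (A i.castSucc 5 + A j.castSucc 5) := by
  have hrow : ∀ i j : Fin 5, i < j → ∀ b : Fin 6, Rmat i j 5 b =
      (if b = i.castSucc then -2 else 0) + (if b = j.castSucc then -2 else 0) +
        (if b = 5 then 3 else 0) := by decide +kernel
  simp only [Matrix.mul_apply, hrow i j hij, add_mul, ite_mul, zero_mul, Finset.sum_add_distrib,
    Finset.sum_ite_eq', Finset.mem_univ, if_true]
  ring

lemma Fmat_mul_apply_last (A : Matrix (Fin 6) (Fin 6) ℤ) :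
    (Fmat * A) 5 5 = 9 * A 5 5 - 4 * ∑ i : Fin 5, A i.castSucc 5 := by
  have hrow : ∀ b : Fin 6, Fmat 5 b = -4 + (if b = 5 then 13 else 0) := by decide +kernel
  simp only [Matrix.mul_apply, hrow, add_mul, ite_mul, zero_mul, Finset.sum_add_distrib,
    Finset.sum_ite_eq', Finset.mem_univ, if_true, ← Finset.mul_sum]
  rw [Fin.sum_univ_castSucc]
  change -4 * (_ + A 5 5) + _ = _
  ring

lemma CongrIdModTwo.dvd_of_ne {A : Matrix (Fin 6) (Fin 6) ℤ} (hA : CongrIdModTwo A)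
    {i j : Fin 6} (hij : i ≠ j) : 2 ∣ A i j := by
  simpa [Matrix.one_apply_ne hij] using hA i j

lemma CongrIdModTwo.dvd_sub_one {A : Matrix (Fin 6) (Fin 6) ℤ} (hA : CongrIdModTwo A)
    (i : Fin 6) : 2 ∣ A i i - 1 := by
  simpa using hA i i

/-- An element of the congruence two subgroup that fixes `e₆` is a diagonal sign matrix. -/
lemma exists_eq_diagonalGL {A : GL (Fin 6) ℤ} (hA : IsLorentzian A.1) (hA2 : CongrIdModTwo A.1)
    (h1 : A.1 5 5 = 1) : ∃ f : Fin 6 → ℤˣ, f 5 = 1 ∧ A = diagonalGL f := by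
  have hcol : ∀ i : Fin 5, A.1 i.castSucc 5 = 0 := by
    have h := hA.sum_col_mul_col 5 5
    rw [h1, show lorJ 5 5 = -1 from rfl] at h
    have h0 : ∑ i : Fin 5, A.1 i.castSucc 5 * A.1 i.castSucc 5 = 0 := by linarith
    rw [Finset.sum_eq_zero_iff_of_nonneg fun i _ => mul_self_nonneg _] at h0
    exact fun i => mul_self_eq_zero.1 (h0 i (Finset.mem_univ i))
  have hrow : ∀ j : Fin 5, A.1 5 j.castSucc = 0 := by
    intro j
    have h := hA.sum_col_mul_col j.castSucc 5
    have hJ : ∀ j : Fin 5, lorJ j.castSucc 5 = 0 := by decide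
    rw [hJ] at h
    simpa [hcol, h1] using h
  have hblock : ∀ j : Fin 5, A.1 j.castSucc j.castSucc * A.1 j.castSucc j.castSucc = 1 ∧
      ∀ i, i ≠ j → A.1 i.castSucc j.castSucc = 0 := by
    intro j
    have h := hA.sum_col_mul_col j.castSucc j.castSucc
    have hJ : ∀ j : Fin 5, lorJ j.castSucc j.castSucc = 1 := by decide
    rw [hrow, hJ, ← Finset.add_sum_erase _ _ (Finset.mem_univ j)] at h
    have hne : A.1 j.castSucc j.castSucc ≠ 0 := fun h0 => by
      have := hA2.dvd_sub_one j.castSucc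
      omega
    have hpos := mul_self_pos.2 hne
    have hnn := Finset.sum_nonneg fun i (_ : i ∈ Finset.univ.erase j) =>
      mul_self_nonneg (A.1 i.castSucc j.castSucc)
    have h0 : ∑ i ∈ Finset.univ.erase j, A.1 i.castSucc j.castSucc * A.1 i.castSucc j.castSucc
        = 0 := by linarith
    refine ⟨by linarith, fun i hij => ?_⟩
    rw [Finset.sum_eq_zero_iff_of_nonneg fun i _ => mul_self_nonneg _] at h0
    exact mul_self_eq_zero.1 (h0 i (by simp [hij]))
  have hdiag : ∀ i, A.1 i i * A.1 i i = 1 := by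
    intro i
    induction i using Fin.lastCases with
    | last => exact (congrArg₂ (· * ·) h1 h1).trans (one_mul 1)
    | cast i => exact (hblock i).1
  refine ⟨fun i => ⟨A.1 i i, A.1 i i, hdiag i, hdiag i⟩, Units.ext h1, Units.ext ?_⟩
  rw [coe_diagonalGL]
  ext i j
  by_cases hij : i = j
  · subst hij; simp
  rw [Matrix.diagonal_apply_ne _ hij]
  induction i using Fin.lastCases with
  | last =>
    induction j using Fin.lastCases with
    | last => exact absurd rfl hij
    | cast j => exact hrow j
  | cast i =>
    induction j using Fin.lastCases with
    | last => exact hcol i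
    | cast j => exact (hblock j).2 i fun h => hij (congrArg _ h)

/-- A matrix of the congruence two subgroup with nonnegative spatial coordinates in its last column
and `(6,6)` entry greater than one has that entry decreased by one of the reflections `R_{ij}`
or `F`. -/
lemma exists_mul_apply_last_lt {A : Matrix (Fin 6) (Fin 6) ℤ} (hA : IsPosLorentzian A)
    (hA2 : CongrIdModTwo A) (hnn : ∀ i : Fin 5, 0 ≤ A i.castSucc 5) (h1 : 1 < A 5 5) :
    (∃ i j, i < j ∧ (Rmat i j * A) 5 5 < A 5 5) ∨ (Fmat * A) 5 5 < A 5 5 := by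
  by_contra! h
  obtain ⟨hR, hF⟩ := h
  refine absurd (time_le_one_of_mem_polytope hnn
    (fun i => hA2.dvd_of_ne (Fin.castSucc_ne_last i)) hA.2 (hA2.dvd_sub_one 5) ?_ ?_ ?_)
    (not_le.2 h1)
  · have h := hA.1.sum_col_mul_col 5 5
    rw [show lorJ 5 5 = -1 from rfl] at h
    simp only [pow_two]
    linarith
  · have hlt : ∀ i j : Fin 5, i < j → A i.castSucc 5 + A j.castSucc 5 ≤ A 5 5 := by
      intro i j hij
      have := hR i j hij
      rw [Rmat_mul_apply_last hij] at this
      linarith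
    intro i j hij
    rcases lt_or_gt_of_ne hij with h | h
    · exact hlt i j h
    · rw [add_comm]; exact hlt j i h
  · rw [Fmat_mul_apply_last] at hF
    linarith

/-- The congruence two subgroup `Γ⁵₂` is generated by the 16 matrices `Dᵢ`, `R_{ij}` and `F`,
each of which is an involution lying in `Γ⁵₂` (the reflections in the 16 sides of the
right-angled polytope `P⁵`). -/
theorem gamma52_generated_by_sixteen_reflections
    (Γ52 : Subgroup (GL (Fin 6) ℤ))
    (hΓ52 : ∀ A : GL (Fin 6) ℤ, A ∈ Γ52 ↔
      IsPosLorentzian (A : Matrix (Fin 6) (Fin 6) ℤ) ∧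
        CongrIdModTwo (A : Matrix (Fin 6) (Fin 6) ℤ))
    (S : Set (GL (Fin 6) ℤ))
    (hS : ∀ g : GL (Fin 6) ℤ, g ∈ S ↔
      ((∃ i : Fin 5, (g : Matrix (Fin 6) (Fin 6) ℤ) = Dmat i) ∨
       (∃ i j : Fin 5, i < j ∧ (g : Matrix (Fin 6) (Fin 6) ℤ) = Rmat i j) ∨
       (g : Matrix (Fin 6) (Fin 6) ℤ) = Fmat)) :
    (∀ g ∈ S, g ∈ Γ52 ∧ g * g = 1 ∧ g ≠ 1) ∧ Subgroup.closure S = Γ52 := by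
  have hmem : ∀ g ∈ S, g ∈ Γ52 ∧ g * g = 1 ∧ g ≠ 1 := by
    intro g hg
    have key : ∀ M : Matrix (Fin 6) (Fin 6) ℤ, g.1 = M → IsPosLorentzian M → CongrIdModTwo M →
        M * M = 1 → M ≠ 1 → g ∈ Γ52 ∧ g * g = 1 ∧ g ≠ 1 := by
      rintro M rfl h1 h2 h3 h4
      exact ⟨(hΓ52 g).2 ⟨h1, h2⟩, Units.ext h3, fun h => h4 (congrArg Units.val h)⟩
    rcases (hS g).1 hg with ⟨i, h⟩ | ⟨i, j, hij, h⟩ | h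
    · exact key _ h (Dmat_isPosLorentzian i) (Dmat_congrIdModTwo i) (Dmat_mul_self i)
        (Dmat_ne_one i)
    · exact key _ h (Rmat_isPosLorentzian hij) (Rmat_congrIdModTwo hij) (Rmat_mul_self hij)
        (Rmat_ne_one i j)
    · exact key _ h Fmat_isPosLorentzian Fmat_congrIdModTwo Fmat_mul_self Fmat_ne_one
  have hle : Subgroup.closure S ≤ Γ52 := (Subgroup.closure_le _).2 fun g hg => (hmem g hg).1
  have hdiag : ∀ f : Fin 6 → ℤˣ, f 5 = 1 → diagonalGL f ∈ Subgroup.closure S := fun f hf =>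
    diagonalGL_mem (fun g hg => Subgroup.subset_closure ((hS g).2 (Or.inl hg))) hf
  refine ⟨hmem, le_antisymm hle ?_⟩
  suffices ∀ (n : ℕ) (A : GL (Fin 6) ℤ), A ∈ Γ52 → (A.1 5 5).toNat = n →
      A ∈ Subgroup.closure S from fun A hA => this _ A hA rfl
  intro n
  induction n using Nat.strong_induction_on with
  | _ n ih =>
    intro A hA hn
    obtain ⟨hApos, hA2⟩ := (hΓ52 A).1 hA
    rcases (show 1 ≤ A.1 5 5 from hApos.2).eq_or_lt with h1 | h1
    · obtain ⟨f, hf, rfl⟩ := exists_eq_diagonalGL hApos.1 hA2 h1.symm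
      exact hdiag f hf
    let f : Fin 6 → ℤˣ := fun i => if 0 ≤ A.1 i 5 then 1 else -1
    have hf5 : f 5 = 1 := if_pos hApos.2.le
    have hf := hdiag f hf5
    have hB := Γ52.mul_mem (hle hf) hA
    have hnn : ∀ i, 0 ≤ (diagonalGL f * A).1 i 5 := by
      intro i
      rw [coe_diagonalGL_mul_apply]
      by_cases h : 0 ≤ A.1 i 5
      · simp [f, h]
      · simp only [f, h, if_false, Units.val_neg, Units.val_one]
        linarith
    have h55 : (diagonalGL f * A).1 5 5 = A.1 5 5 := by
      rw [coe_diagonalGL_mul_apply, hf5, Units.val_one, one_mul]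
    rw [← Subgroup.mul_mem_cancel_left _ hf]
    generalize diagonalGL f * A = B at hB hnn h55
    obtain ⟨hBpos, hB2⟩ := (hΓ52 B).1 hB
    have step : ∀ g ∈ S, (g.1 * B.1) 5 5 < B.1 5 5 → B ∈ Subgroup.closure S := by
      intro g hg hlt
      have hg' := Subgroup.subset_closure hg
      rw [← Subgroup.mul_mem_cancel_left _ hg']
      refine ih _ ?_ _ (Γ52.mul_mem (hle hg') hB) rfl
      rw [Units.val_mul]
      omega
    rcases exists_mul_apply_last_lt hBpos hB2 (fun i => hnn _) (h55 ▸ h1) with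
      ⟨i, j, hij, h⟩ | h
    · exact step ⟨_, _, Rmat_mul_self hij, Rmat_mul_self hij⟩
        ((hS _).2 (Or.inr (Or.inl ⟨i, j, hij, rfl⟩))) h
    · exact step ⟨_, _, Fmat_mul_self, Fmat_mul_self⟩ ((hS _).2 (Or.inr (Or.inr rfl))) h
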